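/- Let x, y be nonzero rational numbers and let (u, v) be a rational point on the elliptic curve v² = u(u + x²)(u + y²) with u + x² ≠ 0. Then, setting a = v/(y(u + x²)), the quantity y²a⁴ + (4x² − 2y²)a² + y² is the square of a rational number. -/

import Mathlib

/-- If `(u, v)` is a rational point on `v² = u(u + x²)(u + y²)` with `u + x² ≠ 0`
(and `x, y` nonzero), then with `a = v/(y(u + x²))` the quartic value
`y²a⁴ + (4x² − 2y²)a² + y²` is a rational square. -/
theorem quartic_square_of_curve_point (x y u v : ℚ) (hx : x ≠ 0) (hy : y ≠ 0)
    (hcurve : v ^ 2 = u * (u + x ^ 2) * (u + y ^ 2)) (hu : u + x ^ 2 ≠ 0) :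
    ∃ d : ℚ, y ^ 2 * (v / (y * (u + x ^ 2))) ^ 4
      + (4 * x ^ 2 - 2 * y ^ 2) * (v / (y * (u + x ^ 2))) ^ 2 + y ^ 2 = d ^ 2 := by
  have ha : (v / (y * (u + x ^ 2))) ^ 2 = u * (u + y ^ 2) / (y ^ 2 * (u + x ^ 2)) := by
    rw [div_pow, hcurve]
    field_simp
  refine ⟨(u ^ 2 + 2 * x ^ 2 * u + x ^ 2 * y ^ 2) / (y * (u + x ^ 2)), ?_⟩
  rw [show (v / (y * (u + x ^ 2))) ^ 4 = ((v / (y * (u + x ^ 2))) ^ 2) ^ 2 by ring, ha]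
  field_simp
  ring
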